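/- arXiv:1811.12447 — 2 statements merged into one kernel-verified Lean document; each statement's English description precedes it below -/
import Mathlib

section
/- There exists an absolute constant C > 0 such that the following holds. Let r, m, ℓ be natural numbers with 1 ≤ ℓ and 1 ≤ r < m, and write γ = r/m, c_γ = 1/(1-γ), d_γ = (2-γ)/(1-γ)². Then W_{m,r}(2^{-ℓ}) ≤ 2^{C·m⁴ + 17·(c_γ·ℓ + d_γ)·γ^{ℓ-1}·binom(m,≤r)}. -/
open Finset

abbrev Cube (m : ℕ) := Fin m → ZMod 2
abbrev BF (m : ℕ) := Cube m → ZMod 2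

/-- Codewords of RM(m,r): functions computed by a polynomial of total degree ≤ r. -/
def RM (m r : ℕ) : Set (BF m) :=
  {f | ∃ p : MvPolynomial (Fin m) (ZMod 2), p.totalDegree ≤ r ∧
    ∀ x, MvPolynomial.eval x p = f x}

/-- Normalized weight of a Boolean function. -/
noncomputable def wt {m : ℕ} (f : BF m) : ℝ :=
  ((univ.filter fun x => f x = 1).card : ℝ) / 2 ^ m

/-- Bias of a Boolean function. -/
noncomputable def bias {m : ℕ} (f : BF m) : ℝ :=
  (∑ x : Cube m, if f x = 0 then (1 : ℝ) else -1) / 2 ^ m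

/-- Number of codewords of RM(m,r) of weight at most β. -/
noncomputable def W (m r : ℕ) (β : ℝ) : ℕ :=
  Set.ncard {f : BF m | f ∈ RM m r ∧ wt f ≤ β}

/-- binom(n, ≤ k) = ∑_{i=0}^k C(n,i). -/
def binomLe (n k : ℕ) : ℕ := ∑ i ∈ Finset.range (k + 1), n.choose i

/-- The sign `(-1)^a` of an element of `ZMod 2`. -/
noncomputable def sgn (a : ZMod 2) : ℝ := if a = 0 then 1 else -1

lemma sgn_add (a b : ZMod 2) : sgn (a + b) = sgn a * sgn b := by
  have h : ∀ a b : ZMod 2, (a = 0 ∧ b = 0 ∧ a + b = 0) ∨ (a = 0 ∧ b ≠ 0 ∧ a + b ≠ 0) ∨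
      (a ≠ 0 ∧ b = 0 ∧ a + b ≠ 0) ∨ (a ≠ 0 ∧ b ≠ 0 ∧ a + b = 0) := by decide
  rcases h a b with ⟨h1, h2, h3⟩ | ⟨h1, h2, h3⟩ | ⟨h1, h2, h3⟩ | ⟨h1, h2, h3⟩ <;>
    simp [sgn, h1, h2, h3]

lemma sgn_eq_or (a : ZMod 2) : sgn a = 1 ∨ sgn a = -1 := by
  unfold sgn; split_ifs <;> simp

lemma sgn_mul_self (a : ZMod 2) : sgn a * sgn a = 1 := by
  rcases sgn_eq_or a with h | h <;> simp [h]

lemma zmod_two_add_self (a : ZMod 2) : a + a = 0 := by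
  revert a; decide

lemma cube_add_self {m : ℕ} (y : Cube m) : y + y = 0 :=
  funext fun i => zmod_two_add_self (y i)

lemma sum_sgn {m : ℕ} (f : BF m) : ∑ x, sgn (f x) = 2 ^ m * (1 - 2 * wt f) := by
  have h : ∀ x, sgn (f x) = 1 - 2 * (if f x = 1 then (1 : ℝ) else 0) := by
    intro x
    have : ∀ a : ZMod 2, a = 0 ∨ a = 1 := by decide
    rcases this (f x) with h | h <;> simp [sgn, h]; norm_num
  simp_rw [h, Finset.sum_sub_distrib, ← Finset.mul_sum, Finset.sum_boole, wt]
  simp [ZMod.card]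
  field_simp

lemma wt_add_le {m : ℕ} (f g : BF m) : wt (f + g) ≤ wt f + wt g := by
  unfold wt
  rw [← add_div]
  gcongr
  have : (univ.filter fun x => (f + g) x = 1) ⊆
      (univ.filter fun x => f x = 1) ∪ (univ.filter fun x => g x = 1) := by
    intro x
    have : ∀ a b : ZMod 2, a + b = 1 → a = 1 ∨ b = 1 := by decide
    simpa using this (f x) (g x)
  exact_mod_cast (Finset.card_le_card this).trans (Finset.card_union_le _ _)

lemma wt_translate {m : ℕ} (f : BF m) (y : Cube m) : wt (fun x => f (x + y)) = wt f := by
  unfold wt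
  congr 2
  refine Finset.card_bij (fun x _ => x + y) ?_ ?_ ?_
  · intro x hx; simpa using hx
  · intro x _ x' _ h; simpa using h
  · intro x hx
    refine ⟨x + y, ?_, ?_⟩ <;> simp [add_assoc, cube_add_self] at hx ⊢
    exact hx

/-- The directional derivative of `f` in direction `y`. -/
def deriv₂ {m : ℕ} (y : Cube m) (f : BF m) : BF m := fun x => f (x + y) + f x

/-- The iterated directional derivative in the directions `Y 0, …, Y (k - 1)`. -/
def iterDeriv₂ {m : ℕ} : (k : ℕ) → (Fin k → Cube m) → BF m → BF m
  | 0, _, f => f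
  | k + 1, Y, f => iterDeriv₂ k (Fin.tail Y) (deriv₂ (Y 0) f)

lemma wt_deriv₂_le {m : ℕ} (y : Cube m) (f : BF m) : wt (deriv₂ y f) ≤ 2 * wt f := by
  have := wt_add_le (fun x => f (x + y)) f
  rw [wt_translate] at this
  have h : deriv₂ y f = (fun x => f (x + y)) + f := rfl
  rw [h]; linarith

lemma sum_sgn_deriv₂ {m : ℕ} (f : BF m) (x : Cube m) :
    ∑ y, sgn (deriv₂ y f x) = 2 ^ m * (1 - 2 * wt f) * sgn (f x) := by
  simp_rw [deriv₂, sgn_add, ← Finset.sum_mul]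
  congr 1
  rw [← sum_sgn]
  exact Equiv.sum_comp (Equiv.addLeft x) fun y => sgn (f y)

lemma sum_cons_tail {α : Type*} [Fintype α] {k : ℕ} (G : α → (Fin k → α) → ℝ) :
    ∑ Y : Fin (k + 1) → α, G (Y 0) (Fin.tail Y) = ∑ y, ∑ Y, G y Y := by
  rw [← Equiv.sum_comp (Fin.consEquiv fun _ => α), Fintype.sum_prod_type]
  rfl

/-- A function of small weight is, pointwise and up to signs, a positive combination of bounded
total mass of its iterated derivatives. -/
lemma exists_weights {m : ℕ} : ∀ (k : ℕ) (f : BF m), wt f ≤ (1 / 2) ^ (k + 1) →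
    ∃ w : (Fin k → Cube m) → ℝ, (∀ Y, 0 ≤ w Y) ∧
      ∑ Y, w Y ≤ (∏ s ∈ range k, (1 - (1 / 2 : ℝ) ^ (s + 1)))⁻¹ ∧
      ∀ x, ∑ Y, w Y * sgn (iterDeriv₂ k Y f x) = sgn (f x)
  | 0, f, _ => ⟨fun _ => 1, by simp, by simp, by simp [iterDeriv₂]⟩
  | k + 1, f, hf => by
    have hD : ∀ y, wt (deriv₂ y f) ≤ (1 / 2) ^ (k + 1) := fun y =>
      (wt_deriv₂_le y f).trans (by rw [pow_succ] at hf; linarith)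
    choose w hw0 hw1 hw2 using fun y => exists_weights k (deriv₂ y f) (hD y)
    set b : ℝ := 1 - 2 * wt f with hb
    have hq : (1 / 2 : ℝ) ^ (k + 1) ≤ 1 / 2 := by
      rw [pow_succ]
      have : (1 / 2 : ℝ) ^ k ≤ 1 := pow_le_one₀ (by norm_num) (by norm_num)
      linarith
    have hb1 : 1 - (1 / 2 : ℝ) ^ (k + 1) ≤ b := by
      rw [pow_succ] at hf; linarith
    have hb0 : 0 < b := by linarith
    refine ⟨fun Y => (2 ^ m * b)⁻¹ * w (Y 0) (Fin.tail Y), ?_, ?_, ?_⟩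
    · intro Y
      have := hw0 (Y 0) (Fin.tail Y)
      positivity
    · rw [← Finset.mul_sum, sum_cons_tail w, Finset.prod_range_succ, mul_inv (∏ s ∈ range k, _)]
      set P := (∏ s ∈ range k, (1 - (1 / 2 : ℝ) ^ (s + 1)))⁻¹
      have hP : 0 ≤ P := (Finset.sum_nonneg fun Y _ => hw0 0 Y).trans (hw1 0)
      have h1 : ∑ y, ∑ Y, w y Y ≤ 2 ^ m * P := by
        refine (Finset.sum_le_sum fun y _ => hw1 y).trans (le_of_eq ?_)
        simp [P, ZMod.card]
      calc (2 ^ m * b)⁻¹ * ∑ y, ∑ Y, w y Y ≤ (2 ^ m * b)⁻¹ * (2 ^ m * P) := by gcongr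
        _ = P * b⁻¹ := by field_simp
        _ ≤ _ := by
          gcongr
          linarith
    · intro x
      simp only [iterDeriv₂, mul_assoc, ← Finset.mul_sum]
      rw [sum_cons_tail fun y Y => w y Y * sgn (iterDeriv₂ k Y (deriv₂ y f) x)]
      simp only [hw2, sum_sgn_deriv₂, ← hb]
      field_simp

lemma prod_one_sub_half_pow_ge_of_le {k : ℕ} (hk : 3 ≤ k) :
    (7 / 25 : ℝ) * (1 + 8 / 7 * (1 / 2) ^ k) ≤ ∏ s ∈ range k, (1 - (1 / 2 : ℝ) ^ (s + 1)) := by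
  induction k, hk using Nat.le_induction with
  | base => norm_num [Finset.prod_range_succ]
  | succ k hk ih =>
    rw [Finset.prod_range_succ, pow_succ]
    have h1 : (1 / 2 : ℝ) ^ k ≤ (1 / 2) ^ 3 :=
      pow_le_pow_of_le_one (by norm_num) (by norm_num) hk
    have h0 : (0 : ℝ) < (1 / 2) ^ k := by positivity
    nlinarith [mul_le_mul_of_nonneg_right ih (by linarith : 0 ≤ 1 - (1 / 2 : ℝ) ^ k * (1 / 2))]

lemma prod_one_sub_half_pow_ge (k : ℕ) :
    (7 / 25 : ℝ) ≤ ∏ s ∈ range k, (1 - (1 / 2 : ℝ) ^ (s + 1)) := by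
  rcases lt_or_ge k 3 with hk | hk
  · interval_cases k <;> norm_num [Finset.prod_range_succ]
  · refine le_trans ?_ (prod_one_sub_half_pow_ge_of_le hk)
    have h0 : (0 : ℝ) < (1 / 2) ^ k := by positivity
    linarith

/-- Majority vote, ties being decided in favour of `1`. -/
noncomputable def majority {t : ℕ} (v : Fin t → ZMod 2) : ZMod 2 :=
  if 0 < ∑ j, sgn (v j) then 0 else 1

lemma one_le_prod_of_majority_ne {t : ℕ} (v : Fin t → ZMod 2) (a : ZMod 2)
    (h : a + majority v = 1) : 1 ≤ ∏ j, (25 / 24 - 7 / 24 * (sgn a * sgn (v j))) := by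
  have hs : sgn a * ∑ j, sgn (v j) ≤ 0 := by
    have h2 : ∀ a : ZMod 2, a = 0 ∨ a = 1 := by decide
    unfold majority at h
    split_ifs at h with hm <;> rcases h2 a with rfl | rfl <;> simp_all [sgn]
    exact hm.le
  have hp : ∀ j, 25 / 24 - 7 / 24 * (sgn a * sgn (v j)) =
      (3 / 4 : ℝ) ^ (sgn a * sgn (v j)) := by
    intro j
    rw [← sgn_add]
    rcases sgn_eq_or (a + v j) with h | h <;> rw [h]
    · norm_num
    · rw [Real.rpow_neg_one]; norm_num
  simp_rw [hp]
  rw [← Real.rpow_sum_of_pos (by norm_num), ← Finset.mul_sum]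
  exact Real.one_le_rpow_of_pos_of_le_one_of_nonpos (by norm_num) (by norm_num) hs

/-- A function of weight at most `2^{-(k+1)}` is a majority vote of `17(k+3)` of its `k`-th order
derivatives, up to error `2^{-(k+3)}`. -/
lemma exists_majority_approx {m k : ℕ} (f : BF m) (hf : wt f ≤ (1 / 2) ^ (k + 1)) :
    ∃ Y : Fin (17 * (k + 3)) → Fin k → Cube m,
      wt (fun x => f x + majority fun j => iterDeriv₂ k (Y j) f x) ≤ (1 / 2) ^ (k + 3) := by
  obtain ⟨w, hw0, hw1, hw2⟩ := exists_weights k f hf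
  set S := ∑ Y, w Y with hS
  have hS1 : 1 ≤ S := by
    calc (1 : ℝ) = sgn (f 0) * ∑ Y, w Y * sgn (iterDeriv₂ k Y f 0) := by
          rw [hw2, sgn_mul_self]
      _ = ∑ Y, w Y * sgn (f 0 + iterDeriv₂ k Y f 0) := by
          rw [Finset.mul_sum]; refine Finset.sum_congr rfl fun Y _ => ?_
          rw [sgn_add]; ring
      _ ≤ S := by
          refine Finset.sum_le_sum fun Y _ => ?_
          have := hw0 Y
          rcases sgn_eq_or (f 0 + iterDeriv₂ k Y f 0) with h | h <;> rw [h] <;> linarith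
  have hS2 : S ≤ 25 / 7 := by
    refine hw1.trans ?_
    rw [inv_le_comm₀ (lt_of_lt_of_le (by norm_num) (prod_one_sub_half_pow_ge k)) (by norm_num)]
    simpa using prod_one_sub_half_pow_ge k
  set t := 17 * (k + 3) with ht
  by_contra! hcon
  have hpoint : ∀ x, ∑ Y : Fin t → Fin k → Cube m, (∏ j, w (Y j)) *
      (if f x + majority (fun j => iterDeriv₂ k (Y j) f x) = 1 then (1 : ℝ) else 0) ≤
      (24 / 25 * S) ^ t := by
    intro x
    calc _ ≤ ∑ Y : Fin t → Fin k → Cube m, ∏ j, (w (Y j) *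
            (25 / 24 - 7 / 24 * (sgn (f x) * sgn (iterDeriv₂ k (Y j) f x)))) := by
          refine Finset.sum_le_sum fun Y _ => ?_
          rw [Finset.prod_mul_distrib]
          refine mul_le_mul_of_nonneg_left ?_ (Finset.prod_nonneg fun j _ => hw0 _)
          split_ifs with h
          · exact one_le_prod_of_majority_ne _ _ h
          · refine Finset.prod_nonneg fun j _ => ?_
            rw [← sgn_add]
            rcases sgn_eq_or (f x + iterDeriv₂ k (Y j) f x) with h | h <;> rw [h] <;> norm_num
      _ = (25 / 24 * S - 7 / 24) ^ t := by
          rw [← Fintype.sum_pow fun Z => w Z *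
            (25 / 24 - 7 / 24 * (sgn (f x) * sgn (iterDeriv₂ k Z f x)))]
          congr 1
          calc _ = 25 / 24 * S - 7 / 24 * (sgn (f x) * ∑ Y, w Y * sgn (iterDeriv₂ k Y f x)) := by
                rw [hS, Finset.mul_sum, Finset.mul_sum, Finset.mul_sum, ← Finset.sum_sub_distrib]
                refine Finset.sum_congr rfl fun Y _ => ?_
                ring
            _ = _ := by rw [hw2, sgn_mul_self, mul_one]
      _ ≤ _ := pow_le_pow_left₀ (by linarith) (by linarith) _
  have hsum := Finset.sum_le_sum fun x (_ : x ∈ (univ : Finset (Cube m))) => hpoint x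
  rw [Finset.sum_comm] at hsum
  simp_rw [← Finset.mul_sum, Finset.sum_boole] at hsum
  have hlow : ∑ Y : Fin t → Fin k → Cube m, (∏ j, w (Y j)) * (2 ^ m * (1 / 2) ^ (k + 3)) <
      ∑ Y : Fin t → Fin k → Cube m, (∏ j, w (Y j)) *
        ((univ.filter fun x => f x + majority (fun j => iterDeriv₂ k (Y j) f x) = 1).card : ℝ) := by
    have hlt : ∀ Y : Fin t → Fin k → Cube m, 2 ^ m * (1 / 2 : ℝ) ^ (k + 3) <
        ((univ.filter fun x => f x + majority (fun j => iterDeriv₂ k (Y j) f x) = 1).card : ℝ) := by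
      intro Y
      have := hcon Y
      rw [wt, lt_div_iff₀ (by positivity)] at this
      linarith
    obtain ⟨Y₀, -, hY₀⟩ : ∃ Y ∈ univ, 0 < w Y := by
      by_contra! h
      have := Finset.sum_nonpos h
      linarith
    refine Finset.sum_lt_sum (fun Y _ => ?_) ⟨fun _ => Y₀, Finset.mem_univ _, ?_⟩
    · exact mul_le_mul_of_nonneg_left (hlt Y).le (Finset.prod_nonneg fun j _ => hw0 _)
    · exact mul_lt_mul_of_pos_left (hlt _) (Finset.prod_pos fun j _ => hY₀)
  rw [← Finset.sum_mul, ← Fintype.sum_pow, ← hS] at hlow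
  have hfin := hlow.trans_le hsum
  rw [Finset.sum_const, Finset.card_univ, Fintype.card_fun, ZMod.card, Fintype.card_fin,
    nsmul_eq_mul, mul_pow] at hfin
  have h96 : (24 / 25 : ℝ) ^ t ≤ (1 / 2) ^ (k + 3) := by
    rw [ht, pow_mul]
    exact pow_le_pow_left₀ (by norm_num) (by norm_num) _
  have : (0 : ℝ) < S ^ t := by positivity
  have h2 : (2 : ℝ) ^ m * ((24 / 25) ^ t * S ^ t) ≤ 2 ^ m * ((1 / 2) ^ (k + 3) * S ^ t) := by gcongr
  push_cast at hfin
  linarith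

/-- The monomial function `x ↦ ∏_{i ∈ S} x_i`. -/
def monomialFun {m : ℕ} (S : Finset (Fin m)) : BF m := fun x => ∏ i ∈ S, x i

/-- The span of the monomial functions of degree at most `r`. -/
def degLE (m r : ℕ) : Submodule (ZMod 2) (BF m) :=
  Submodule.span (ZMod 2) (monomialFun '' {S | S.card ≤ r})

lemma monomialFun_mem_degLE {m r : ℕ} {S : Finset (Fin m)} (h : S.card ≤ r) :
    monomialFun S ∈ degLE m r :=
  Submodule.subset_span ⟨S, h, rfl⟩

lemma RM_subset_degLE (m r : ℕ) : RM m r ⊆ degLE m r := by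
  rintro f ⟨p, hp, hf⟩
  have hpow : ∀ (a : ZMod 2) (n : ℕ), n ≠ 0 → a ^ n = a := by
    intro a n hn
    have : ∀ a : ZMod 2, a = 0 ∨ a = 1 := by decide
    rcases this a with rfl | rfl <;> simp [hn]
  have : f = ∑ d ∈ p.support, p.coeff d • monomialFun d.support := by
    funext x
    rw [← hf, MvPolynomial.eval_eq, Finset.sum_apply]
    refine Finset.sum_congr rfl fun d _ => ?_
    rw [Pi.smul_apply, smul_eq_mul, monomialFun]
    congr 1
    exact Finset.prod_congr rfl fun i hi => hpow _ _ (Finsupp.mem_support_iff.1 hi)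
  rw [this]
  refine Submodule.sum_mem _ fun d hd => Submodule.smul_mem _ _ (monomialFun_mem_degLE ?_)
  refine le_trans ?_ ((MvPolynomial.le_totalDegree hd).trans hp)
  rw [Finsupp.sum, Finset.card_eq_sum_ones]
  exact Finset.sum_le_sum fun i hi => Nat.one_le_iff_ne_zero.2 (Finsupp.mem_support_iff.1 hi)

lemma card_filter_card_le (m r : ℕ) :
    (univ.filter fun S : Finset (Fin m) => S.card ≤ r).card = binomLe m r := by
  rw [binomLe, Finset.card_eq_sum_card_fiberwise (f := Finset.card) (t := range (r + 1))]
  · refine Finset.sum_congr rfl fun i hi => ?_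
    have : i ≤ r := Nat.lt_succ_iff.1 (Finset.mem_range.1 hi)
    conv_rhs => rw [← Fintype.card_fin m, ← Finset.card_univ, ← Finset.card_powersetCard]
    congr 1
    ext S
    simp only [Finset.mem_filter, Finset.mem_univ, true_and, Finset.mem_powersetCard,
      Finset.subset_univ]
    omega
  · intro S hS
    simpa [Nat.lt_succ_iff] using hS

lemma card_degLE_le (m r : ℕ) : Nat.card (degLE m r) ≤ 2 ^ binomLe m r := by
  classical
  rw [Module.natCard_eq_pow_finrank (K := ZMod 2), Nat.card_zmod]
  refine Nat.pow_le_pow_right (by norm_num) ?_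
  have h : monomialFun '' {S : Finset (Fin m) | S.card ≤ r} =
      (((univ.filter fun S : Finset (Fin m) => S.card ≤ r).image monomialFun : Finset (BF m)) :
        Set (BF m)) := by
    simp
  rw [degLE, h, ← card_filter_card_le]
  exact (finrank_span_finset_le_card _).trans Finset.card_image_le

lemma degLE_mono {m r s : ℕ} (h : r ≤ s) : degLE m r ≤ degLE m s :=
  Submodule.span_mono (Set.image_mono fun _ hS => le_trans hS h)

lemma mul_mem_degLE {m r s : ℕ} {f g : BF m} (hf : f ∈ degLE m r) (hg : g ∈ degLE m s) :
    f * g ∈ degLE m (r + s) := by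
  have h : degLE m r * degLE m s ≤ degLE m (r + s) := by
    rw [degLE, degLE, Submodule.span_mul_span, Submodule.span_le]
    rintro _ ⟨_, ⟨S, hS, rfl⟩, _, ⟨T, hT, rfl⟩, rfl⟩
    have : monomialFun S * monomialFun T = monomialFun (S ∪ T) := by
      funext x
      have hsq : ∀ a : ZMod 2, a * a = a := by decide
      simp only [Pi.mul_apply, monomialFun]
      rw [← Finset.prod_union_inter, ← Finset.prod_sdiff
        (Finset.inter_subset_left.trans Finset.subset_union_left : S ∩ T ⊆ S ∪ T), mul_assoc, hsq]
    change monomialFun S * monomialFun T ∈ _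
    rw [this]
    exact monomialFun_mem_degLE ((Finset.card_union_le _ _).trans (add_le_add hS hT))
  exact h (Submodule.mul_mem_mul hf hg)

lemma one_mem_degLE (m r : ℕ) : (1 : BF m) ∈ degLE m r := by
  have : (1 : BF m) = monomialFun ∅ := by funext x; simp [monomialFun]
  rw [this]
  exact monomialFun_mem_degLE (by simp)

lemma comp_mem_degLE {m n r : ℕ} (A : Cube n →ₗ[ZMod 2] Cube m) {f : BF m}
    (hf : f ∈ degLE m r) : (fun x => f (A x)) ∈ degLE n r := by
  have hlin : ∀ i, (fun x => A x i) ∈ degLE n 1 := by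
    intro i
    have : (fun x => A x i) = ∑ j, A (Pi.single j 1) i • monomialFun {j} := by
      funext x
      conv_lhs => rw [LinearMap.pi_apply_eq_sum_univ A x]
      rw [Finset.sum_apply, Finset.sum_apply]
      refine Finset.sum_congr rfl fun j _ => ?_
      have hj : (fun l => if j = l then (1 : ZMod 2) else 0) = Pi.single j 1 := by
        ext l
        simp [Pi.single_apply, eq_comm]
      rw [hj]
      simp [monomialFun, mul_comm]
    rw [this]
    exact Submodule.sum_mem _ fun j _ =>
      Submodule.smul_mem _ _ (monomialFun_mem_degLE (by simp))
  have hle : degLE m r ≤ (degLE n r).comap (LinearMap.funLeft (ZMod 2) (ZMod 2) A) := by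
    rw [degLE, Submodule.span_le]
    rintro _ ⟨S, hS, rfl⟩
    refine degLE_mono hS (?_ : (fun x => ∏ i ∈ S, A x i) ∈ degLE n S.card)
    clear hS
    induction S using Finset.induction_on with
    | empty => exact one_mem_degLE n 0
    | insert i S hi ih =>
      simp_rw [Finset.prod_insert hi]
      rw [Finset.card_insert_of_notMem hi, add_comm]
      exact mul_mem_degLE (hlin i) ih
  exact hle hf

lemma deriv₂_add {m : ℕ} (y : Cube m) (f g : BF m) :
    deriv₂ y (f + g) = deriv₂ y f + deriv₂ y g := by
  funext x; simp only [deriv₂, Pi.add_apply]; ring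

/-- The derivative in direction `y` as a linear map. -/
def derivLin {m : ℕ} (y : Cube m) : BF m →ₗ[ZMod 2] BF m where
  toFun := deriv₂ y
  map_add' := deriv₂_add y
  map_smul' c f := by funext x; simp [deriv₂, mul_add]

lemma deriv₂_monomialFun {m : ℕ} (y : Cube m) (S : Finset (Fin m)) :
    deriv₂ y (monomialFun S) = ∑ T ∈ S.ssubsets, (∏ i ∈ S \ T, y i) • monomialFun T := by
  funext x
  simp only [deriv₂, monomialFun, Pi.add_apply, Finset.prod_add, Finset.sum_apply, Pi.smul_apply,
    smul_eq_mul]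
  rw [← Finset.sum_erase_add _ _ (Finset.mem_powerset_self S), add_assoc]
  simp only [Finset.sdiff_self, Finset.prod_empty, mul_one, zmod_two_add_self, add_zero]
  exact Finset.sum_congr rfl fun T _ => mul_comm _ _

lemma deriv₂_mem_degLE {m r : ℕ} (y : Cube m) {f : BF m} (hf : f ∈ degLE m (r + 1)) :
    deriv₂ y f ∈ degLE m r := by
  have hle : degLE m (r + 1) ≤ (degLE m r).comap (derivLin y) := by
    rw [degLE, Submodule.span_le]
    rintro _ ⟨S, hS, rfl⟩
    change deriv₂ y (monomialFun S) ∈ degLE m r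
    rw [deriv₂_monomialFun]
    refine Submodule.sum_mem _ fun T hT => Submodule.smul_mem _ _ (monomialFun_mem_degLE ?_)
    have := Finset.card_lt_card (Finset.mem_ssubsets.1 hT)
    have : S.card ≤ r + 1 := hS
    omega
  exact hle hf

lemma deriv₂_eq_zero_of_mem_degLE_zero {m : ℕ} (y : Cube m) {f : BF m} (hf : f ∈ degLE m 0) :
    deriv₂ y f = 0 := by
  have hle : degLE m 0 ≤ LinearMap.ker (derivLin y) := by
    rw [degLE, Submodule.span_le]
    rintro _ ⟨S, hS, rfl⟩
    change deriv₂ y (monomialFun S) = 0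
    have : S = ∅ := by simpa using hS
    rw [deriv₂_monomialFun, this]
    rfl
  exact hle hf

lemma eq_zero_of_forall_deriv₂_eq_zero {m : ℕ} {f : BF m} (h : ∀ y, deriv₂ y f = 0)
    (hf : wt f ≤ 1 / 2) : f = 0 := by
  by_contra hne
  obtain ⟨x, hx⟩ := Function.ne_iff.1 hne
  have h2 : ∀ a b : ZMod 2, a + b = 0 → b ≠ 0 → a = 1 := by decide
  have hone : ∀ z, f z = 1 := by
    intro z
    have := congrFun (h (x + z)) x
    rw [deriv₂, ← add_assoc, cube_add_self, zero_add] at this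
    exact h2 _ _ this hx
  have : wt f = 1 := by simp [wt, hone, ZMod.card]
  linarith

lemma eq_zero_of_wt_le {m : ℕ} : ∀ (r : ℕ) {f : BF m}, f ∈ degLE m r →
    wt f ≤ (1 / 2) ^ (r + 1) → f = 0
  | 0, f, hf, hw => eq_zero_of_forall_deriv₂_eq_zero
      (fun y => deriv₂_eq_zero_of_mem_degLE_zero y hf) (by simpa using hw)
  | r + 1, f, hf, hw => by
    refine eq_zero_of_forall_deriv₂_eq_zero (fun y => ?_) (hw.trans ?_)
    · refine eq_zero_of_wt_le r (deriv₂_mem_degLE y hf) ((wt_deriv₂_le y f).trans ?_)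
      rw [pow_succ] at hw; linarith
    · have : (1 / 2 : ℝ) ^ (r + 1 + 1) ≤ (1 / 2) ^ 1 :=
        pow_le_pow_of_le_one (by norm_num) (by norm_num) (by omega)
      simpa using this

lemma iterDeriv₂_mem_degLE {m s : ℕ} : ∀ (k : ℕ) (Y : Fin k → Cube m) {f : BF m},
    f ∈ degLE m (s + k) → iterDeriv₂ k Y f ∈ degLE m s
  | 0, _, _, hf => hf
  | k + 1, Y, _, hf => iterDeriv₂_mem_degLE k (Fin.tail Y) (deriv₂_mem_degLE (Y 0) hf)

lemma deriv₂_comm {m : ℕ} (y z : Cube m) (f : BF m) :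
    deriv₂ y (deriv₂ z f) = deriv₂ z (deriv₂ y f) := by
  funext x
  simp only [deriv₂, add_right_comm x y z]
  ring

lemma iterDeriv₂_deriv₂ {m : ℕ} : ∀ (k : ℕ) (Y : Fin k → Cube m) (y : Cube m) (f : BF m),
    iterDeriv₂ k Y (deriv₂ y f) = deriv₂ y (iterDeriv₂ k Y f)
  | 0, _, _, _ => rfl
  | k + 1, Y, y, f => by
    rw [iterDeriv₂, deriv₂_comm, iterDeriv₂_deriv₂]
    rfl

lemma deriv₂_self {m : ℕ} (y : Cube m) (f : BF m) : deriv₂ y (deriv₂ y f) = 0 := by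
  funext x
  simp only [deriv₂, add_assoc x y y, cube_add_self, add_zero, Pi.zero_apply]
  rw [add_comm (f x), zmod_two_add_self]

lemma deriv₂_iterDeriv₂_eq_zero {m : ℕ} : ∀ (k : ℕ) (Y : Fin k → Cube m) (j : Fin k) (f : BF m),
    deriv₂ (Y j) (iterDeriv₂ k Y f) = 0
  | k + 1, Y, j, f => by
    rw [iterDeriv₂]
    refine Fin.cases ?_ (fun j => ?_) j
    · rw [iterDeriv₂_deriv₂, deriv₂_self]
    · exact deriv₂_iterDeriv₂_eq_zero k (Fin.tail Y) j _

lemma add_eq_of_deriv₂_eq_zero {m : ℕ} {y : Cube m} {f : BF m} (h : deriv₂ y f = 0)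
    (x : Cube m) : f (x + y) = f x := by
  have h2 : ∀ a b : ZMod 2, a + b = 0 → a = b := by decide
  exact h2 _ _ (congrFun h x)

lemma iterDeriv₂_add_of_mem_span {m k : ℕ} (Y : Fin k → Cube m) (f : BF m) {y : Cube m}
    (hy : y ∈ Submodule.span (ZMod 2) (Set.range Y)) :
    ∀ x, iterDeriv₂ k Y f (x + y) = iterDeriv₂ k Y f x := by
  induction hy using Submodule.span_induction with
  | mem y hy =>
    obtain ⟨j, rfl⟩ := hy
    exact add_eq_of_deriv₂_eq_zero (deriv₂_iterDeriv₂_eq_zero k Y j f)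
  | zero => simp
  | add y z _ _ hy hz => intro x; rw [← add_assoc, hz, hy]
  | smul c y _ hy =>
    intro x
    have : ∀ a : ZMod 2, a = 0 ∨ a = 1 := by decide
    rcases this c with rfl | rfl
    · simp
    · rw [one_smul, hy]

lemma iterDeriv₂_zero {m : ℕ} : ∀ (k : ℕ) (Y : Fin k → Cube m), iterDeriv₂ k Y 0 = 0
  | 0, _ => rfl
  | k + 1, Y => by
    have : deriv₂ (Y 0) (0 : BF m) = 0 := (derivLin (Y 0)).map_zero
    rw [iterDeriv₂, this, iterDeriv₂_zero]

lemma iterDeriv₂_eq_zero_of_not_linearIndependent {m : ℕ} : ∀ (k : ℕ) (Y : Fin k → Cube m)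
    (f : BF m), ¬ LinearIndependent (ZMod 2) Y → iterDeriv₂ k Y f = 0
  | 0, _, _, h => (h linearIndependent_empty_type).elim
  | k + 1, Y, f, h => by
    rw [← Fin.cons_self_tail Y, linearIndependent_finCons, not_and_or, not_not] at h
    rw [iterDeriv₂]
    rcases h with h | h
    · exact iterDeriv₂_eq_zero_of_not_linearIndependent k _ _ h
    · rw [iterDeriv₂_deriv₂]
      funext x
      rw [deriv₂, iterDeriv₂_add_of_mem_span _ _ h, zmod_two_add_self, Pi.zero_apply]

/-- The number of iterated derivatives in given directions of polynomials of bounded degree. -/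
lemma ncard_image_iterDeriv₂_le {m s k : ℕ} (Y : Fin k → Cube m) :
    ((iterDeriv₂ k Y) '' (degLE m (s + k) : Set (BF m))).ncard ≤ 2 ^ binomLe (m - k) s := by
  by_cases hY : LinearIndependent (ZMod 2) Y
  · obtain ⟨U, hU⟩ := Submodule.exists_isCompl (Submodule.span (ZMod 2) (Set.range Y))
    have hdim : Module.finrank (ZMod 2) U = m - k := by
      have := Submodule.finrank_add_eq_of_isCompl hU
      rw [finrank_span_eq_card hY, Fintype.card_fin, Module.finrank_fin_fun] at this
      omega
    let e := (Module.finBasisOfFinrankEq (ZMod 2) U hdim).equivFun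
    let A : Cube (m - k) →ₗ[ZMod 2] Cube m := U.subtype ∘ₗ e.symm.toLinearMap
    refine le_trans ?_ (card_degLE_le (m - k) s)
    rw [← SetLike.coe_sort_coe, Nat.card_coe_set_eq]
    refine Set.ncard_le_ncard_of_injOn (fun g x => g (A x)) ?_ ?_
    · rintro _ ⟨f, hf, rfl⟩
      exact comp_mem_degLE A (iterDeriv₂_mem_degLE k Y hf)
    · rintro _ ⟨f, -, rfl⟩ _ ⟨f', -, rfl⟩ h
      funext x
      obtain ⟨y, hy, u, hu, rfl⟩ := Submodule.mem_sup.1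
        (hU.sup_eq_top ▸ Submodule.mem_top : x ∈ _ ⊔ U)
      have := congrFun h (e ⟨u, hu⟩)
      simp only [A, LinearMap.comp_apply, LinearEquiv.coe_coe, LinearEquiv.symm_apply_apply,
        Submodule.subtype_apply] at this
      rw [add_comm, iterDeriv₂_add_of_mem_span Y f hy, iterDeriv₂_add_of_mem_span Y f' hy, this]
  · refine (Set.ncard_le_ncard (t := {0}) ?_).trans ?_
    · rintro _ ⟨f, -, rfl⟩
      exact iterDeriv₂_eq_zero_of_not_linearIndependent k Y f hY
    · rw [Set.ncard_singleton]; exact Nat.one_le_two_pow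

/-- The polynomials of degree at most `r` and of weight at most `2^{-i}`. -/
def lowWeight (m r i : ℕ) : Set (BF m) := {f | f ∈ degLE m r ∧ wt f ≤ (1 / 2) ^ i}

lemma wt_add_le_of_approx {m : ℕ} (f f' h : BF m) :
    wt (f + f') ≤ wt (fun x => f x + h x) + wt (fun x => f' x + h x) := by
  have hsum : f + f' = (fun x => f x + h x) + fun x => f' x + h x := by
    funext x
    simp only [Pi.add_apply]
    rw [add_add_add_comm, zmod_two_add_self, add_zero]
  rw [hsum]
  exact wt_add_le _ _

lemma ncard_lowWeight_succ_le (m s k : ℕ) :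
    (lowWeight m (s + k) (k + 1)).ncard ≤
      (2 ^ (m * k) * 2 ^ binomLe (m - k) s) ^ (17 * (k + 3)) *
        (lowWeight m (s + k) (k + 2)).ncard := by
  classical
  set t := 17 * (k + 3)
  have hex : ∀ f : BF m, ∃ Y : Fin t → Fin k → Cube m, wt f ≤ (1 / 2) ^ (k + 1) →
      wt (fun x => f x + majority fun j => iterDeriv₂ k (Y j) f x) ≤ (1 / 2) ^ (k + 3) := by
    intro f
    by_cases hf : wt f ≤ (1 / 2) ^ (k + 1)
    · exact (exists_majority_approx f hf).imp fun Y hY _ => hY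
    · exact ⟨fun _ _ => 0, fun h => absurd h hf⟩
  choose Y hY using hex
  let D : (Fin k → Cube m) → Finset (BF m) := fun Z =>
    (iterDeriv₂ k Z '' (degLE m (s + k) : Set (BF m))).toFinset
  let P : Finset (Σ _ : Fin k → Cube m, BF m) := univ.sigma D
  let Φ : BF m → Fin t → Σ _ : Fin k → Cube m, BF m := fun f j => ⟨Y f j, iterDeriv₂ k (Y f j) f⟩
  have hP : P.card ≤ 2 ^ (m * k) * 2 ^ binomLe (m - k) s := by
    rw [Finset.card_sigma]
    refine (Finset.sum_le_card_nsmul _ _ (2 ^ binomLe (m - k) s) fun Z _ => ?_).trans ?_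
    · rw [← Set.ncard_eq_toFinset_card']
      exact ncard_image_iterDeriv₂_le Z
    · simp [ZMod.card, pow_mul]
  have hmaps : ∀ f ∈ (lowWeight m (s + k) (k + 1)).toFinset, Φ f ∈ Fintype.piFinset fun _ => P := by
    intro f hf
    rw [Set.mem_toFinset] at hf
    simp only [Fintype.mem_piFinset, P, Finset.mem_sigma, Finset.mem_univ, true_and, D,
      Set.mem_toFinset, Φ]
    exact fun j => ⟨f, hf.1, rfl⟩
  have hfib : ∀ c ∈ Fintype.piFinset fun _ : Fin t => P,
      ((lowWeight m (s + k) (k + 1)).toFinset.filter fun f => Φ f = c).card ≤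
        (lowWeight m (s + k) (k + 2)).ncard := by
    intro c _
    rw [Set.ncard_eq_toFinset_card']
    rcases ((lowWeight m (s + k) (k + 1)).toFinset.filter fun f => Φ f = c).eq_empty_or_nonempty
      with h | ⟨f, hf⟩
    · rw [h]; simp
    rw [Finset.mem_filter, Set.mem_toFinset] at hf
    have happ : ∀ g : BF m, g ∈ lowWeight m (s + k) (k + 1) → Φ g = c →
        wt (fun x => g x + majority fun j => (c j).2 x) ≤ (1 / 2) ^ (k + 3) := by
      rintro g hg rfl
      exact hY g hg.2
    refine Finset.card_le_card_of_injOn (fun g => f + g) ?_ fun g _ g' _ h => add_left_cancel h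
    intro g hg
    rw [Finset.mem_coe, Finset.mem_filter, Set.mem_toFinset] at hg
    rw [Finset.mem_coe, Set.mem_toFinset]
    refine ⟨Submodule.add_mem _ hf.1.1 hg.1.1, ?_⟩
    refine (wt_add_le_of_approx f g _).trans
      ((add_le_add (happ f hf.1 hf.2) (happ g hg.1 hg.2)).trans (le_of_eq ?_))
    ring
  rw [Set.ncard_eq_toFinset_card']
  refine (Finset.card_le_mul_card_image_of_maps_to hmaps _ hfib).trans ?_
  rw [Fintype.card_piFinset_const, mul_comm]
  gcongr

lemma ncard_lowWeight_le_one {m r k : ℕ} (h : r ≤ k) : (lowWeight m r (k + 1)).ncard ≤ 1 := by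
  refine (Set.ncard_le_ncard (t := {0}) fun f hf => eq_zero_of_wt_le r hf.1 (hf.2.trans ?_)).trans
    (Set.ncard_singleton _).le
  exact pow_le_pow_of_le_one (by norm_num) (by norm_num) (Nat.succ_le_succ h)

lemma add_one_mul_binomLe_le (m r : ℕ) :
    (m + 1) * binomLe m r ≤ (r + 1) * binomLe (m + 1) (r + 1) := by
  rw [binomLe, binomLe, Finset.sum_range_succ' _ (r + 1), Finset.mul_sum, mul_add, Finset.mul_sum]
  refine le_trans (Finset.sum_le_sum fun i hi => ?_) (Nat.le_add_right _ _)
  rw [Nat.add_one_mul_choose_eq, mul_comm]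
  have := Finset.mem_range.1 hi
  gcongr
  omega

lemma binomLe_sub_le {m r : ℕ} (hrm : r ≤ m) (hm : 0 < m) : ∀ k s : ℕ, s + k = r →
    (binomLe (m - k) s : ℝ) ≤ ((r : ℝ) / m) ^ k * binomLe m r
  | 0, s, h => by simp [← h]
  | k + 1, s, h => by
    have ih := binomLe_sub_le hrm hm k (s + 1) (by omega)
    obtain ⟨n, hn⟩ : ∃ n, m - k = n + 1 := ⟨m - k - 1, by omega⟩
    have hn' : m - (k + 1) = n := by omega
    rw [hn] at ih
    rw [hn']
    have h1 : ((n : ℝ) + 1) * binomLe n s ≤ ((s : ℝ) + 1) * binomLe (n + 1) (s + 1) := by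
      exact_mod_cast add_one_mul_binomLe_le n s
    have hm' : (0 : ℝ) < m := by exact_mod_cast hm
    have hratio : ((s : ℝ) + 1) / (n + 1) ≤ r / m := by
      rw [div_le_div_iff₀ (by positivity) hm']
      have hmn : (m : ℝ) = n + 1 + k := by exact_mod_cast (by omega : m = n + 1 + k)
      have hrs : (r : ℝ) = s + 1 + k := by exact_mod_cast (by omega : r = s + 1 + k)
      have hsn : (s : ℝ) ≤ n := by exact_mod_cast (by omega : s ≤ n)
      have hk : (0 : ℝ) ≤ k := by positivity
      rw [hmn, hrs]
      nlinarith
    calc (binomLe n s : ℝ) ≤ ((s : ℝ) + 1) / (n + 1) * binomLe (n + 1) (s + 1) := by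
          rw [div_mul_eq_mul_div, le_div_iff₀ (by positivity)]; linarith
      _ ≤ r / m * (((r : ℝ) / m) ^ k * binomLe m r) := by gcongr
      _ = _ := by ring

lemma ncard_lowWeight_le {m r : ℕ} (hr : r < m) : ∀ n k : ℕ, k + n = r →
    ((lowWeight m r (k + 1)).ncard : ℝ) ≤ (2 : ℝ) ^ (34 * (m : ℝ) ^ 3 * n +
      17 * ((1 / (1 - (r : ℝ) / m)) * ((k : ℝ) + 1) + (2 - (r : ℝ) / m) / (1 - (r : ℝ) / m) ^ 2) *
        ((r : ℝ) / m) ^ k * (binomLe m r : ℝ)) := by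
  have hm : (0 : ℝ) < m := by exact_mod_cast (by omega : 0 < m)
  set γ : ℝ := (r : ℝ) / m with hγ
  have hγ0 : 0 ≤ γ := by positivity
  have hγ1 : 0 < 1 - γ := by
    rw [hγ, sub_pos, div_lt_one hm]; exact_mod_cast hr
  intro n
  induction n with
  | zero =>
    intro k hk
    have h1 : ((lowWeight m r (k + 1)).ncard : ℝ) ≤ 1 := by
      exact_mod_cast ncard_lowWeight_le_one (by omega)
    refine h1.trans (Real.one_le_rpow (by norm_num) ?_)
    have : 0 ≤ 2 - γ := by linarith
    positivity
  | succ n ih =>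
    intro k hk
    have hstep := ncard_lowWeight_succ_le m (n + 1) k
    rw [show n + 1 + k = r by omega, ← pow_add, ← pow_mul] at hstep
    have hB := binomLe_sub_le hr.le (by omega) k (n + 1) (by omega : n + 1 + k = r)
    have ih' := ih (k + 1) (by omega)
    set b := binomLe (m - k) (n + 1)
    set B : ℝ := (binomLe m r : ℝ)
    calc ((lowWeight m r (k + 1)).ncard : ℝ)
        ≤ (2 : ℝ) ^ (((m * k + b) * (17 * (k + 3)) : ℕ) : ℝ) *
            (lowWeight m r (k + 1 + 1)).ncard := by
          rw [Real.rpow_natCast]; exact_mod_cast hstep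
      _ ≤ _ := mul_le_mul_of_nonneg_left ih' (by positivity)
      _ ≤ _ := by
        rw [← Real.rpow_add (by norm_num)]
        refine Real.rpow_le_rpow_of_exponent_le (by norm_num) ?_
        push_cast
        have hkm : (k : ℝ) ≤ m := by exact_mod_cast (by omega : k ≤ m)
        have hk3 : (k : ℝ) + 3 ≤ 2 * m := by exact_mod_cast (by omega : k + 3 ≤ 2 * m)
        have hfirst : (m : ℝ) * k * (17 * (k + 3)) ≤ 34 * m ^ 3 := by
          calc (m : ℝ) * k * (17 * (k + 3)) ≤ m * m * (17 * (2 * m)) := by gcongr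
            _ = _ := by ring
        have hsecond : (b : ℝ) * (17 * (k + 3)) ≤ γ ^ k * B * (17 * (k + 3)) := by gcongr
        have hid : 17 * (1 / (1 - γ) * ((k : ℝ) + 1) + (2 - γ) / (1 - γ) ^ 2) * γ ^ k * B =
            γ ^ k * B * (17 * (k + 3)) +
              17 * (1 / (1 - γ) * ((k : ℝ) + 1 + 1) + (2 - γ) / (1 - γ) ^ 2) * γ ^ (k + 1) * B := by
          field_simp
          ring
        rw [hid]
        nlinarith

/-- upper bound on the weight distribution of RM codes for small
weights (Theorem `main thm - low weight`). -/
theorem weight_distribution_low_weight :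
    ∃ C : ℝ, 0 < C ∧ ∀ r m ℓ : ℕ, 1 ≤ ℓ → 1 ≤ r → r < m →
      (W m r ((2 : ℝ) ^ (-(ℓ : ℤ))) : ℝ) ≤
        (2 : ℝ) ^ (C * (m : ℝ) ^ 4 +
          17 * ((1 / (1 - (r : ℝ) / m)) * ℓ + (2 - (r : ℝ) / m) / (1 - (r : ℝ) / m) ^ 2) *
            ((r : ℝ) / m) ^ (ℓ - 1) * (binomLe m r : ℝ)) := by
  refine ⟨34, by norm_num, fun r m ℓ hℓ hr hrm => ?_⟩
  obtain ⟨k, rfl⟩ : ∃ k, ℓ = k + 1 := ⟨ℓ - 1, by omega⟩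
  have hm : (0 : ℝ) < m := by exact_mod_cast (by omega : 0 < m)
  have hγ1 : 0 < 1 - (r : ℝ) / m := by
    rw [sub_pos, div_lt_one hm]; exact_mod_cast hrm
  have hW : W m r ((2 : ℝ) ^ (-((k + 1 : ℕ) : ℤ))) ≤ (lowWeight m r (k + 1)).ncard := by
    refine Set.ncard_le_ncard fun f hf => ⟨RM_subset_degLE m r hf.1, hf.2.trans (le_of_eq ?_)⟩
    rw [zpow_neg, zpow_natCast, one_div, inv_pow]
  refine (Nat.cast_le.2 hW).trans ?_
  rcases le_total k r with hk | hk
  · refine (ncard_lowWeight_le hrm (r - k) k (by omega)).trans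
      (Real.rpow_le_rpow_of_exponent_le (by norm_num) ?_)
    rw [Nat.add_sub_cancel, Nat.cast_add_one]
    have : ((r - k : ℕ) : ℝ) ≤ m := by exact_mod_cast (by omega : r - k ≤ m)
    have h4 : 34 * (m : ℝ) ^ 3 * ((r - k : ℕ) : ℝ) ≤ 34 * (m : ℝ) ^ 4 := by
      calc 34 * (m : ℝ) ^ 3 * ((r - k : ℕ) : ℝ) ≤ 34 * (m : ℝ) ^ 3 * m := by gcongr
        _ = _ := by ring
    gcongr
  · have h1 : ((lowWeight m r (k + 1)).ncard : ℝ) ≤ 1 := by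
      exact_mod_cast ncard_lowWeight_le_one hk
    refine h1.trans (Real.one_le_rpow (by norm_num) ?_)
    have : 0 ≤ 2 - (r : ℝ) / m := by linarith
    positivity
end

section
/- Let r ≤ m be natural numbers and ε > 0. If f is drawn uniformly at random from P(m,r), then Pr[|bias(f)| > ε] ≤ 2·exp(-2^r·ε²/2). -/
open Finset

open Real in
/-- Hoeffding's inequality for a Rademacher sum with coefficients in `[-1, 1]`, in counting form. -/
lemma card_lt_signed_sum_le {ι : Type*} [Fintype ι] [DecidableEq ι] (c : ι → ℝ)
    (hc : ∀ z, |c z| ≤ 1) (ε : ℝ) (hε : 0 < ε) :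
    ((univ.filter fun g : ι → ZMod 2 =>
      Fintype.card ι * ε < ∑ z, c z * (if g z = 0 then (1 : ℝ) else -1)).card : ℝ) ≤
      2 ^ Fintype.card ι * exp (-(Fintype.card ι * ε ^ 2) / 2) := by
  set N := Fintype.card ι
  set S : (ι → ZMod 2) → ℝ := fun g => ∑ z, c z * (if g z = 0 then (1 : ℝ) else -1)
  have moment : ∑ g, exp (ε * S g) ≤ 2 ^ N * exp (N * ε ^ 2 / 2) := by
    calc ∑ g, exp (ε * S g)
        = ∑ g : ι → ZMod 2, ∏ z, exp (ε * (c z * (if g z = 0 then (1 : ℝ) else -1))) := by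
          simp only [S, mul_sum, exp_sum]
      _ = ∏ z, ∑ a : ZMod 2, exp (ε * (c z * (if a = 0 then (1 : ℝ) else -1))) := by
          rw [prod_univ_sum, Fintype.piFinset_univ]
      _ ≤ ∏ _z : ι, (2 * exp (ε ^ 2 / 2)) := by
          refine prod_le_prod (fun z _ => by positivity) fun z _ => ?_
          have hsum : ∑ a : ZMod 2, exp (ε * (c z * (if a = 0 then (1 : ℝ) else -1)))
              = 2 * cosh (ε * c z) := by
            have h2 : (univ : Finset (ZMod 2)) = {0, 1} := by decide
            rw [h2, sum_pair (by decide), cosh_eq]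
            simp
            ring
          rw [hsum]
          have hsq : c z ^ 2 ≤ 1 := (sq_le_one_iff_abs_le_one _).2 (hc z)
          have hle : (ε * c z) ^ 2 / 2 ≤ ε ^ 2 / 2 := by nlinarith [sq_nonneg ε]
          have := (cosh_le_exp_half_sq (ε * c z)).trans (exp_le_exp.2 hle)
          linarith
      _ = 2 ^ N * exp (N * ε ^ 2 / 2) := by
          rw [prod_const, card_univ, mul_pow, ← exp_nat_mul, mul_div_assoc]
  have markov : ((univ.filter fun g => N * ε < S g).card : ℝ) * exp (N * ε ^ 2)
      ≤ ∑ g, exp (ε * S g) := by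
    rw [← nsmul_eq_mul, ← sum_const]
    refine (sum_le_sum fun g hg => ?_).trans
      (sum_le_sum_of_subset_of_nonneg (filter_subset _ _) fun g _ _ => (exp_pos _).le)
    rw [mem_filter] at hg
    exact exp_le_exp.2 (by nlinarith [hg.2])
  have hexp : exp (N * ε ^ 2 / 2) = exp (-(N * ε ^ 2) / 2) * exp (N * ε ^ 2) := by
    rw [← exp_add]; ring_nf
  rw [hexp, ← mul_assoc] at moment
  exact le_of_mul_le_mul_right (markov.trans moment) (exp_pos _)

open Real in
/-- Two-sided version of `card_lt_signed_sum_le`. -/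
lemma card_lt_abs_signed_sum_le {ι : Type*} [Fintype ι] [DecidableEq ι] (c : ι → ℝ)
    (hc : ∀ z, |c z| ≤ 1) (ε : ℝ) (hε : 0 < ε) :
    ((univ.filter fun g : ι → ZMod 2 =>
      Fintype.card ι * ε < |∑ z, c z * (if g z = 0 then (1 : ℝ) else -1)|).card : ℝ) ≤
      2 ^ Fintype.card ι * (2 * exp (-(Fintype.card ι * ε ^ 2) / 2)) := by
  have h1 := card_lt_signed_sum_le c hc ε hε
  have h2 := card_lt_signed_sum_le (fun z => -c z) (by simpa using hc) ε hε
  simp only [neg_mul, sum_neg_distrib] at h2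
  simp only [lt_abs, filter_or]
  have h3 := Nat.cast_le (α := ℝ).2 (card_union_le
    (univ.filter fun g : ι → ZMod 2 =>
      Fintype.card ι * ε < ∑ z, c z * (if g z = 0 then (1 : ℝ) else -1))
    (univ.filter fun g : ι → ZMod 2 =>
      Fintype.card ι * ε < -∑ z, c z * (if g z = 0 then (1 : ℝ) else -1)))
  push_cast at h3
  linarith

lemma add_mem_RM {m r : ℕ} {f g : BF m} (hf : f ∈ RM m r) (hg : g ∈ RM m r) :
    f + g ∈ RM m r := by
  obtain ⟨p, hp, hpf⟩ := hf
  obtain ⟨q, hq, hqg⟩ := hg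
  exact ⟨p + q, (MvPolynomial.totalDegree_add p q).trans (max_le hp hq),
    fun x => by simp [hpf, hqg]⟩

lemma mem_RM_self {r : ℕ} (g : BF r) : g ∈ RM r r := by
  have hg : g ∈ (MvPolynomial.restrictDegree (Fin r) (ZMod 2)
      (Fintype.card (ZMod 2) - 1)).map (MvPolynomial.evalₗ (ZMod 2) (Fin r)) := by
    rw [MvPolynomial.map_restrict_dom_evalₗ]
    trivial
  obtain ⟨p, hp, rfl⟩ := hg
  refine ⟨p, Finset.sup_le fun s hs => ?_, fun x => rfl⟩
  rw [SetLike.mem_coe, MvPolynomial.mem_restrictDegree] at hp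
  rw [Finsupp.sum_fintype _ _ fun _ => rfl]
  refine (sum_le_sum fun i _ => hp s hs i).trans ?_
  simp [ZMod.card]

lemma comp_castLE_mem_RM {m r : ℕ} (hrm : r ≤ m) (g : BF r) :
    (fun x : Cube m => g (x ∘ Fin.castLE hrm)) ∈ RM m r := by
  obtain ⟨p, hp, hpg⟩ := mem_RM_self g
  exact ⟨MvPolynomial.rename (Fin.castLE hrm) p,
    (MvPolynomial.totalDegree_rename_le _ p).trans hp,
    fun x => by rw [MvPolynomial.eval_rename, hpg]⟩

lemma card_filter_comp_castLE {m r : ℕ} (hrm : r ≤ m) (z : Cube r) :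
    2 ^ r * (univ.filter fun x : Cube m => x ∘ Fin.castLE hrm = z).card = 2 ^ m := by
  let φ : Cube m →+ Cube r :=
    { toFun := fun x => x ∘ Fin.castLE hrm, map_zero' := rfl, map_add' := fun _ _ => rfl }
  have hφ : Function.Surjective φ := (Fin.castLE_injective hrm).surjective_comp_right
  have hsum := card_eq_sum_card_fiberwise (f := φ) (s := univ) (t := univ) (by simp)
  have hfib : ∀ w : Cube r, (univ.filter fun x : Cube m => φ x = w).card
      = (univ.filter fun x : Cube m => φ x = z).card := fun w =>
    AddMonoidHom.card_fiber_eq_of_mem_range φ (hφ w) (hφ z)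
  rw [sum_congr rfl fun w _ => hfib w, sum_const] at hsum
  rw [card_univ, card_univ, Fintype.card_fun, Fintype.card_fun, ZMod.card, Fintype.card_fin,
    Fintype.card_fin] at hsum
  exact hsum.symm

lemma sign_add (a b : ZMod 2) : (if a + b = 0 then (1 : ℝ) else -1) =
    (if a = 0 then 1 else -1) * (if b = 0 then 1 else -1) := by
  have hcases : ∀ c : ZMod 2, c = 0 ∨ c = 1 := by decide
  rcases hcases a with rfl | rfl <;> rcases hcases b with rfl | rfl <;>
    simp [CharTwo.add_self_eq_zero]

/-- Hoeffding's inequality on the translates of `f` by functions of the first `r` coordinates. -/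
lemma card_bias_add_comp_castLE_le {m r : ℕ} (hrm : r ≤ m) (ε : ℝ) (hε : 0 < ε) (f : BF m) :
    ((univ.filter fun g : BF r =>
      ε < |bias (f + fun x => g (x ∘ Fin.castLE hrm))|).card : ℝ) ≤
      2 ^ 2 ^ r * (2 * Real.exp (-(2 ^ r * ε ^ 2) / 2)) := by
  set k : Cube r → ℝ := fun z =>
    ∑ x ∈ univ.filter (fun x : Cube m => x ∘ Fin.castLE hrm = z), if f x = 0 then (1 : ℝ) else -1
  have hk : ∀ z, |2 ^ r * k z / 2 ^ m| ≤ 1 := by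
    intro z
    have hcard : (2 : ℝ) ^ r * (univ.filter fun x : Cube m => x ∘ Fin.castLE hrm = z).card
        = 2 ^ m := by exact_mod_cast card_filter_comp_castLE hrm z
    have habs : |k z| ≤ (univ.filter fun x : Cube m => x ∘ Fin.castLE hrm = z).card := by
      refine (abs_sum_le_sum_abs _ _).trans (le_of_eq ?_)
      rw [card_eq_sum_ones, Nat.cast_sum]
      refine sum_congr rfl fun x _ => ?_
      split_ifs <;> simp
    rw [abs_div, abs_mul, abs_of_pos (by positivity : (0 : ℝ) < 2 ^ r),
      abs_of_pos (by positivity : (0 : ℝ) < 2 ^ m), div_le_one (by positivity), ← hcard]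
    gcongr
  have hbias : ∀ g : BF r, 2 ^ r * bias (f + fun x => g (x ∘ Fin.castLE hrm)) =
      ∑ z, (2 ^ r * k z / 2 ^ m) * (if g z = 0 then (1 : ℝ) else -1) := by
    intro g
    have hfib : (∑ x : Cube m, if f x + g (x ∘ Fin.castLE hrm) = 0 then (1 : ℝ) else -1) =
        ∑ z, k z * (if g z = 0 then (1 : ℝ) else -1) := by
      rw [← sum_fiberwise univ (fun x : Cube m => x ∘ Fin.castLE hrm)]
      refine sum_congr rfl fun z _ => ?_
      rw [sum_mul]
      refine sum_congr rfl fun x hx => ?_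
      rw [sign_add, (mem_filter.1 hx).2]
    simp only [bias, Pi.add_apply]
    rw [hfib, sum_div, mul_sum]
    exact sum_congr rfl fun z _ => by ring
  have h := card_lt_abs_signed_sum_le _ hk ε hε
  have hN : Fintype.card (Cube r) = 2 ^ r := by simp [ZMod.card]
  rw [hN] at h
  push_cast at h
  simpa only [← hbias, abs_mul, abs_of_pos (by positivity : (0 : ℝ) < 2 ^ r),
    mul_lt_mul_iff_right₀ (by positivity : (0 : ℝ) < 2 ^ r)] using h

/-- Averaging over translations: if a set `C` is stable under translation by every `t i`, then a
bound on the density of translates of each point of `C` in `B` bounds the density of `B` in `C`. -/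
lemma card_filter_le_of_forall_translate {A ι : Type*} [AddGroup A] [Fintype ι]
    [Nonempty ι] (C : Finset A) (P : A → Prop) [DecidablePred P] (t : ι → A)
    (ht : ∀ i, ∀ f, f + t i ∈ C ↔ f ∈ C) (δ : ℝ)
    (h : ∀ f, ((univ.filter fun i => P (f + t i)).card : ℝ) ≤ Fintype.card ι * δ) :
    ((C.filter P).card : ℝ) ≤ C.card * δ := by
  have htrans : ∀ i, (C.filter fun f => P (f + t i)).card = (C.filter P).card := by
    intro i
    refine card_equiv (Equiv.addRight (t i)) fun f => ?_
    simp [ht]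
  have hdouble := sum_card_bipartiteAbove_eq_sum_card_bipartiteBelow
    (s := C) (t := (univ : Finset ι)) (fun f i => P (f + t i))
  simp only [bipartiteAbove, bipartiteBelow, htrans, sum_const, card_univ, smul_eq_mul] at hdouble
  have hbound := sum_le_sum fun f (_ : f ∈ C) => h f
  rw [← Nat.cast_sum, hdouble, sum_const, nsmul_eq_mul] at hbound
  push_cast at hbound
  have hpos : (0 : ℝ) < Fintype.card ι := by exact_mod_cast Fintype.card_pos
  refine le_of_mul_le_mul_left ?_ hpos
  linarith

/-- concentration of the bias of a uniformly random polynomial of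
degree at most r (Theorem `weak concentration of bias for all gamma`).
The probability Pr_{f ∈ P(m,r)}[|bias f| > ε] is expressed as the number of
bad codewords divided by the total number of codewords. -/
theorem bias_concentration (m r : ℕ) (hrm : r ≤ m) (ε : ℝ) (hε : 0 < ε) :
    (Set.ncard {f : BF m | f ∈ RM m r ∧ ε < |bias f|} : ℝ) /
        (Set.ncard (RM m r) : ℝ) ≤
      2 * Real.exp (-(2 ^ r * ε ^ 2) / 2) := by
  classical
  set C : Finset (BF m) := univ.filter (· ∈ RM m r)
  have hRM : Set.ncard (RM m r) = C.card := by
    rw [← Set.ncard_coe_finset]; simp [C]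
  have hbad : Set.ncard {f : BF m | f ∈ RM m r ∧ ε < |bias f|} =
      (C.filter fun f => ε < |bias f|).card := by
    rw [← Set.ncard_coe_finset]; simp [C, filter_filter]
  have hcomp := comp_castLE_mem_RM hrm
  have htrans : ∀ (g : BF r) (f : BF m),
      (f + fun x => g (x ∘ Fin.castLE hrm)) ∈ C ↔ f ∈ C := by
    intro g f
    simp only [C, mem_filter, mem_univ, true_and]
    refine ⟨fun h => ?_, fun h => add_mem_RM h (hcomp g)⟩
    have h' := add_mem_RM h (hcomp g)
    rwa [add_assoc, CharTwo.add_self_eq_zero, add_zero] at h'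
  rw [hRM, hbad]
  refine div_le_of_le_mul₀ (by positivity) (by positivity) ?_
  rw [mul_comm]
  refine card_filter_le_of_forall_translate C (fun f => ε < |bias f|)
    (fun (g : BF r) x => g (x ∘ Fin.castLE hrm)) htrans _ fun f => ?_
  have hN : (Fintype.card (BF r) : ℝ) = 2 ^ 2 ^ r := by simp [ZMod.card]
  rw [hN]
  exact card_bias_add_comp_castLE_le hrm ε hε f
end
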